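/- Let n ≥ 0, m ≥ 3 be integers and let D be a digraph on {1,…,m} with arc set A(D) containing no loops. Then Σ_{u} Σ_{(p,q)∈A(D)} x_{P_u^p} · (y_{P_u^p, Q_u^q} − x_{Q_u^q} + 1) = |A(H_n^m(D))|, where the outer sum ranges over all states u; in particular this double sum equals (1/2)|A(D)|(m^n − (m−2)^n). -/

import Mathlib

/-- A state of the Tower of Hanoi with `n` discs and `m` pegs is a function assigning to
each disc (smaller index = smaller disc) the peg on which it lies. `(u, v)` is an arc of the
restricted Hanoi graph `H_n^m(D)` moving disc `k` iff (1) only disc `k` changes peg,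
(2) disc `k` is topmost on its peg in `u`, (3) disc `k` becomes topmost on its peg in `v`,
(4) the move of its peg is an arc of the movement digraph with arc set `A`. -/
def HanoiMove {n m : ℕ} (A : Finset (Fin m × Fin m))
    (u v : Fin n → Fin m) (k : Fin n) : Prop :=
  u k ≠ v k ∧ (∀ d, d ≠ k → u d = v d) ∧
    (∀ d, d < k → u d ≠ u k) ∧ (∀ d, d < k → v d ≠ v k) ∧ (u k, v k) ∈ A

/-- `t_k^{n,m}(D)`: the number of arcs of `H_n^m(D)` along which disc `k` is moved.
Here disc `k : Fin n` corresponds to disc `k + 1` of `{1, …, n}` in the paper. -/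
noncomputable def tArcs {n m : ℕ} (A : Finset (Fin m × Fin m)) (k : Fin n) : ℕ :=
  Nat.card {p : (Fin n → Fin m) × (Fin n → Fin m) // HanoiMove A p.1 p.2 k}

/-- `|A(H_n^m(D))|`: the total number of arcs of the restricted Hanoi graph. -/
noncomputable def totalArcs (n m : ℕ) (A : Finset (Fin m × Fin m)) : ℕ :=
  Nat.card {p : (Fin n → Fin m) × (Fin n → Fin m) // ∃ k, HanoiMove A p.1 p.2 k}

/-- `P_u^p`: the set of discs lying on peg `p` in state `u`. -/
def pegSet {n m : ℕ} (u : Fin n → Fin m) (p : Fin m) : Finset (Fin n) :=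
  Finset.univ.filter fun i => u i = p

/-- The indicator `x_A`: `1` if `A ≠ ∅` and `0` otherwise. -/
def xInd {n : ℕ} (A : Finset (Fin n)) : ℤ :=
  if A.Nonempty then 1 else 0

/-- The indicator `y_{A,B}`: `1` if `A ≠ ∅`, `B ≠ ∅` and `min A ≤ min B`, else `0`. -/
def yInd {n : ℕ} (A B : Finset (Fin n)) : ℤ :=
  if A.Nonempty ∧ B.Nonempty ∧ A.min ≤ B.min then 1 else 0

/-- `d⁺(u)`: the outdegree of the state `u` in `H_n^m(D)`, i.e. the number of states `v`
such that `(u, v)` is an arc of `H_n^m(D)`. -/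
noncomputable def outdeg {n m : ℕ} (A : Finset (Fin m × Fin m))
    (u : Fin n → Fin m) : ℕ :=
  Nat.card {v : Fin n → Fin m // ∃ k, HanoiMove A u v k}

/-- Peg `p` is occupied and its top disc is smaller than every disc on peg `q`. -/
def LegalPeg {n m : ℕ} (u : Fin n → Fin m) (p q : Fin m) : Prop :=
  ∃ k, u k = p ∧ ∀ d, d < k → u d ≠ p ∧ u d ≠ q

open Classical in
lemma weight_eq {n m : ℕ} (u : Fin n → Fin m) {p q : Fin m} (hpq : p ≠ q) :
    xInd (pegSet u p) * (yInd (pegSet u p) (pegSet u q) - xInd (pegSet u q) + 1)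
      = if LegalPeg u p q then 1 else 0 := by
  by_cases hP : (pegSet u p).Nonempty
  · have hmp := Finset.min'_mem _ hP
    have hminP : ∀ d, u d = p → (pegSet u p).min' hP ≤ d := fun d hd =>
      Finset.min'_le _ _ (by simp [pegSet, hd])
    have hup : u ((pegSet u p).min' hP) = p := by simpa [pegSet] using hmp
    by_cases hQ : (pegSet u q).Nonempty
    · have hmq := Finset.min'_mem _ hQ
      have hminQ : ∀ d, u d = q → (pegSet u q).min' hQ ≤ d := fun d hd =>
        Finset.min'_le _ _ (by simp [pegSet, hd])
      have huq : u ((pegSet u q).min' hQ) = q := by simpa [pegSet] using hmq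
      have key : (pegSet u p).min ≤ (pegSet u q).min ↔ LegalPeg u p q := by
        rw [← Finset.coe_min' hP, ← Finset.coe_min' hQ, WithTop.coe_le_coe]
        constructor
        · intro h
          refine ⟨_, hup, fun d hd => ⟨fun e => ?_, fun e => ?_⟩⟩
          · exact absurd (hminP d e) (not_le.2 hd)
          · exact absurd (h.trans (hminQ d e)) (not_le.2 hd)
        · rintro ⟨k, hk, hd⟩
          refine (hminP k hk).trans ?_
          by_contra hlt
          exact (hd _ (not_le.1 hlt)).2 huq
      simp only [xInd, yInd, hP, hQ, key, true_and, if_true]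
      ring
    · have : LegalPeg u p q := by
        refine ⟨_, hup, fun d hd => ⟨fun e => ?_, fun e => ?_⟩⟩
        · exact absurd (hminP d e) (not_le.2 hd)
        · exact hQ ⟨d, by simp [pegSet, e]⟩
      simp [xInd, yInd, hP, hQ, this]
  · have : ¬ LegalPeg u p q := by
      rintro ⟨k, hk, -⟩
      exact hP ⟨k, by simp [pegSet, hk]⟩
    simp [xInd, hP, this]

open Classical in
lemma legal_add {n m : ℕ} (u : Fin n → Fin m) {p q : Fin m} (hpq : p ≠ q) :
    (if LegalPeg u p q then (1 : ℤ) else 0) + (if LegalPeg u q p then 1 else 0)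
      = 1 - if (∀ i, u i ≠ p ∧ u i ≠ q) then 1 else 0 := by
  by_cases h : ∀ i, u i ≠ p ∧ u i ≠ q
  · have h1 : ¬ LegalPeg u p q := fun ⟨k, hk, _⟩ => (h k).1 hk
    have h2 : ¬ LegalPeg u q p := fun ⟨k, hk, _⟩ => (h k).2 hk
    simp [h, h1, h2]
  · have hex : ∃ i, u i = p ∨ u i = q := by
      by_contra hc
      push Not at hc
      exact h hc
    obtain ⟨k, hk, hmin⟩ : ∃ k, (u k = p ∨ u k = q) ∧
        ∀ d, d < k → ¬ (u d = p ∨ u d = q) := by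
      obtain ⟨k, hk, hmin⟩ := WellFounded.has_min (wellFounded_lt (α := Fin n))
        {i | u i = p ∨ u i = q} hex
      exact ⟨k, hk, fun d hd hh => hmin d hh hd⟩
    rcases hk with hk | hk
    · have h1 : LegalPeg u p q := ⟨k, hk, fun d hd => by simpa using hmin d hd⟩
      have h2 : ¬ LegalPeg u q p := by
        rintro ⟨j, hj, hd⟩
        rcases lt_trichotomy j k with hl | hl | hl
        · exact hmin j hl (Or.inr hj)
        · subst hl; exact hpq (hk.symm.trans hj)
        · exact (hd k hl).2 hk
      simp [h, h1, h2]
    · have h1 : LegalPeg u q p := ⟨k, hk, fun d hd => by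
        have := hmin d hd
        tauto⟩
      have h2 : ¬ LegalPeg u p q := by
        rintro ⟨j, hj, hd⟩
        rcases lt_trichotomy j k with hl | hl | hl
        · exact hmin j hl (Or.inl hj)
        · subst hl; exact hpq (hj.symm.trans hk)
        · exact (hd k hl).2 hk
      simp [h, h1, h2]

open Classical in
lemma legal_symm {n m : ℕ} (p q : Fin m) :
    (∑ u : Fin n → Fin m, if LegalPeg u q p then (1 : ℤ) else 0)
      = ∑ u : Fin n → Fin m, if LegalPeg u p q then (1 : ℤ) else 0 := by
  refine Fintype.sum_equiv (Equiv.arrowCongr (Equiv.refl _) (Equiv.swap p q)) _ _ ?_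
  intro u
  have : LegalPeg u q p ↔
      LegalPeg ((Equiv.arrowCongr (Equiv.refl (Fin n)) (Equiv.swap p q)) u) p q := by
    have e1 : ∀ x : Fin m, Equiv.swap p q x = p ↔ x = q := fun x => by
      rw [Equiv.swap_apply_eq_iff, Equiv.swap_apply_left]
    have e2 : ∀ x : Fin m, Equiv.swap p q x = q ↔ x = p := fun x => by
      rw [Equiv.swap_apply_eq_iff, Equiv.swap_apply_right]
    simp [LegalPeg, Equiv.arrowCongr_apply, e1, e2]
  simp only [this]

open Classical in
lemma avoid_count {n m : ℕ} (hm : 3 ≤ m) {p q : Fin m} (hpq : p ≠ q) :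
    (∑ u : Fin n → Fin m, if (∀ i, u i ≠ p ∧ u i ≠ q) then (1 : ℤ) else 0)
      = ((m : ℤ) - 2) ^ n := by
  rw [Finset.sum_boole]
  have h : (Finset.univ.filter fun u : Fin n → Fin m => ∀ i, u i ≠ p ∧ u i ≠ q)
      = Fintype.piFinset fun _ => (({p, q} : Finset (Fin m))ᶜ) := by
    ext u
    simp
  rw [h, Fintype.card_piFinset_const, Finset.card_compl, Finset.card_pair hpq, Fintype.card_fin]
  rw [Nat.cast_pow, Nat.cast_sub (by omega)]
  simp

open Classical in
lemma legal_count {n m : ℕ} (hm : 3 ≤ m) {p q : Fin m} (hpq : p ≠ q) :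
    2 * (∑ u : Fin n → Fin m, if LegalPeg u p q then (1 : ℤ) else 0)
      = (m : ℤ) ^ n - ((m : ℤ) - 2) ^ n := by
  have h := Finset.sum_congr (rfl : (Finset.univ : Finset (Fin n → Fin m)) = Finset.univ)
    (fun u _ => legal_add u hpq)
  rw [Finset.sum_add_distrib, legal_symm p q, Finset.sum_sub_distrib, avoid_count hm hpq] at h
  rw [two_mul, h]
  simp

lemma arcs_card {n m : ℕ} (A : Finset (Fin m × Fin m)) (hA : ∀ p, (p, p) ∉ A) :
    Nat.card {x : (Fin n → Fin m) × (Fin m × Fin m) // x.2 ∈ A ∧ LegalPeg x.1 x.2.1 x.2.2}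
      = totalArcs n m A := by
  have hne : ∀ x : Fin m × Fin m, x ∈ A → x.1 ≠ x.2 := by
    rintro ⟨a, b⟩ hx (rfl : a = b)
    exact hA _ hx
  choose k hk hd using fun x : {x : (Fin n → Fin m) × (Fin m × Fin m) //
    x.2 ∈ A ∧ LegalPeg x.1 x.2.1 x.2.2} => x.2.2
  refine Nat.card_eq_of_bijective (fun x =>
    ⟨(x.1.1, Function.update x.1.1 (k x) x.1.2.2), k x, ?_⟩) ⟨?_, ?_⟩
  · refine ⟨?_, ?_, ?_, ?_, ?_⟩
    · simpa [hk] using hne _ x.2.1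
    · intro d h
      simp [h]
    · intro d h
      simpa [hk] using (hd x d h).1
    · intro d h
      simpa [h.ne] using (hd x d h).2
    · simpa [hk] using x.2.1
  · intro x y hxy
    simp only [Subtype.mk.injEq, Prod.mk.injEq] at hxy
    obtain ⟨h1, h2⟩ := hxy
    have hkk : k x = k y := by
      by_contra hc
      have := congrFun h2 (k x)
      rw [Function.update_self, Function.update_of_ne hc, ← h1, hk] at this
      exact hne _ x.2.1 this.symm
    have hq : x.1.2.2 = y.1.2.2 := by
      have := congrFun h2 (k x)
      rw [Function.update_self, hkk, Function.update_self] at this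
      exact this
    have hp : x.1.2.1 = y.1.2.1 := by
      rw [← hk x, ← hk y, h1, hkk]
    exact Subtype.ext (Prod.ext h1 (Prod.ext hp hq))
  · rintro ⟨⟨u, v⟩, j, h1, h2, h3, h4, h5⟩
    simp only at h1 h2 h3 h4 h5
    let x : {x : (Fin n → Fin m) × (Fin m × Fin m) //
        x.2 ∈ A ∧ LegalPeg x.1 x.2.1 x.2.2} :=
      ⟨(u, (u j, v j)), h5, j, rfl, fun d hdj => ⟨h3 d hdj, by
        show u d ≠ v j
        rw [h2 d hdj.ne]; exact h4 d hdj⟩⟩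
    have hkj : k x = j := by
      have a1 : u (k x) = u j := hk x
      rcases lt_trichotomy (k x) j with hl | hl | hl
      · exact absurd a1 (h3 _ hl)
      · exact hl
      · exact absurd rfl (hd x j hl).1
    refine ⟨x, Subtype.ext (Prod.ext rfl ?_)⟩
    show Function.update u (k x) (v j) = v
    rw [hkj]
    funext d
    by_cases hdj : d = j
    · subst hdj; simp
    · simp [hdj, h2 d hdj]

/-- `Σ_u Σ_{(p,q) ∈ A(D)} x_{P_u^p} · (y_{P_u^p, Q_u^q} - x_{Q_u^q} + 1) = |A(H_n^m(D))|`,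
the outer sum ranging over all states `u`; in particular this double sum equals
`(1/2) · |A(D)| · (m^n - (m-2)^n)`. -/
theorem sum_outdeg_formula (n m : ℕ) (hm : 3 ≤ m) (A : Finset (Fin m × Fin m))
    (hA : ∀ p, (p, p) ∉ A) :
    (∑ u : Fin n → Fin m, ∑ pq ∈ A,
        xInd (pegSet u pq.1) *
          (yInd (pegSet u pq.1) (pegSet u pq.2) - xInd (pegSet u pq.2) + 1))
        = (totalArcs n m A : ℤ) ∧
      2 * (∑ u : Fin n → Fin m, ∑ pq ∈ A,
          xInd (pegSet u pq.1) *
            (yInd (pegSet u pq.1) (pegSet u pq.2) - xInd (pegSet u pq.2) + 1))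
        = (A.card : ℤ) * ((m : ℤ) ^ n - ((m : ℤ) - 2) ^ n) := by
  classical
  have hne : ∀ x : Fin m × Fin m, x ∈ A → x.1 ≠ x.2 := by
    rintro ⟨a, b⟩ hx (rfl : a = b)
    exact hA _ hx
  have hS : (∑ u : Fin n → Fin m, ∑ pq ∈ A,
        xInd (pegSet u pq.1) *
          (yInd (pegSet u pq.1) (pegSet u pq.2) - xInd (pegSet u pq.2) + 1))
      = ∑ u : Fin n → Fin m, ∑ pq ∈ A, if LegalPeg u pq.1 pq.2 then (1 : ℤ) else 0 :=
    Finset.sum_congr rfl fun u _ => Finset.sum_congr rfl fun pq h => weight_eq u (hne pq h)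
  rw [hS]
  constructor
  · rw [← arcs_card A hA, Nat.card_eq_fintype_card, Fintype.card_subtype,
      ← Finset.sum_product', Finset.sum_boole]
    congr 2
    ext x
    simp
  · rw [Finset.sum_comm, Finset.mul_sum,
      Finset.sum_congr rfl fun pq h => legal_count hm (hne pq h)]
    simp
    ring
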